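/- Let m ≥ 1 be an integer, β > 2, C₀ > 0, ℋ > 1, s₀ > 1, ḡ(t) := 1 + C₀ t^{−β/2}, c₁ > 0 and c₂ ∈ ℝ. Define W(s) := ( s^{−ℋ}( ∫_1^s ℋ t^{ℋ−1} ḡ(t) dt + c₁ ) )^{1/m} and w(s) := c₂ + ∫_{s₀}^s W(η) dη for s ≥ 1. Then the improper integral μ := c₂ − s₀ + ∫_{s₀}^∞ (W(η) − 1) dη converges, and: if ℋ ≠ β/2, there exist C > 0 and s₁ ≥ 1 such that |w(s) − s − μ| ≤ C s^{1−min{β/2, ℋ}} for all s ≥ s₁; if ℋ = β/2, there exist C > 0 and s₁ > 1 such that |w(s) − s − μ| ≤ C s^{1−ℋ} ln s for all s ≥ s₁. -/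

import Mathlib

open scoped BigOperators
open Filter MeasureTheory

noncomputable section

/-- The `j`-th elementary symmetric function of `lam ∈ ℝⁿ`. -/
def esym (n j : ℕ) (lam : Fin n → ℝ) : ℝ :=
  ∑ S ∈ Finset.powersetCard j (Finset.univ : Finset (Fin n)), ∏ i ∈ S, lam i

/-- `σ_{j;i}`: the `j`-th elementary symmetric function with the `i`-th variable set to `0`. -/
def esymRem (n j : ℕ) (lam : Fin n → ℝ) (i : Fin n) : ℝ :=
  esym n j (Function.update lam i 0)

/-- The increasingly ordered eigenvalue vector of a real symmetric matrix
(junk value `0` if the matrix is not symmetric). -/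
def eigs {n : ℕ} (M : Matrix (Fin n) (Fin n) ℝ) : Fin n → ℝ :=
  if h : M.IsHermitian then h.eigenvalues ∘ (Tuple.sort h.eigenvalues) else 0

/-- The Hessian matrix `D²u(x)` of `u : ℝⁿ → ℝ`. -/
def hessianMatrix {n : ℕ} (u : EuclideanSpace ℝ (Fin n) → ℝ) (x : EuclideanSpace ℝ (Fin n)) :
    Matrix (Fin n) (Fin n) ℝ :=
  fun i j =>
    fderiv ℝ (fun y => fderiv ℝ u y (EuclideanSpace.single j 1)) x (EuclideanSpace.single i 1)

/-- The quadratic form `½ xᵀ A x`. -/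
def quadForm {n : ℕ} (A : Matrix (Fin n) (Fin n) ℝ) (x : EuclideanSpace ℝ (Fin n)) : ℝ :=
  (1 / 2) * ∑ i, ∑ j, A i j * x i * x j

/-- The Gårding cone `Γ_k = {λ : σ_j(λ) > 0, 1 ≤ j ≤ k}`. -/
def GammaK (n k : ℕ) : Set (Fin n → ℝ) :=
  {lam | ∀ j, 1 ≤ j → j ≤ k → 0 < esym n j lam}

/-- The Hessian quotient operator `S_{k,l}(M) = σ_k(λ(M))/σ_l(λ(M))`. -/
def Skl (n k l : ℕ) (M : Matrix (Fin n) (Fin n) ℝ) : ℝ :=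
  esym n k (eigs M) / esym n l (eigs M)

/-- `H_k(A) = max_i σ_{k-1;i}(λ(A)) λ_i(A) / σ_k(λ(A))`. -/
def Hk (n k : ℕ) (A : Matrix (Fin n) (Fin n) ℝ) : ℝ :=
  ⨆ i : Fin n, esymRem n (k - 1) (eigs A) i * eigs A i / esym n k (eigs A)

/-- `ψ` is admissible on the open set `A` with respect to the cone `Γ`:
it is `C²` on `A` and `λ(D²ψ) ∈ Γ` there. -/
def Admissible {n : ℕ} (Γ : Set (Fin n → ℝ)) (A : Set (EuclideanSpace ℝ (Fin n)))
    (ψ : EuclideanSpace ℝ (Fin n) → ℝ) : Prop :=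
  ContDiffOn ℝ 2 ψ A ∧ ∀ x ∈ A, eigs (hessianMatrix ψ x) ∈ Γ

/-- Viscosity subsolution of `F(D²u) = g` on `Ω` (for `F` of the form `f(λ(D²u))`). -/
def ViscSubsolution {n : ℕ} (Γ : Set (Fin n → ℝ)) (F : Matrix (Fin n) (Fin n) ℝ → ℝ)
    (g : EuclideanSpace ℝ (Fin n) → ℝ) (Ω : Set (EuclideanSpace ℝ (Fin n)))
    (u : EuclideanSpace ℝ (Fin n) → ℝ) : Prop :=
  UpperSemicontinuousOn u Ω ∧
    ∀ Aset : Set (EuclideanSpace ℝ (Fin n)), Aset ⊆ Ω → IsOpen Aset →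
      ∀ ψ : EuclideanSpace ℝ (Fin n) → ℝ, Admissible Γ Aset ψ →
        ∀ x₀ ∈ Aset, IsLocalMaxOn (fun y => u y - ψ y) Aset x₀ →
          g x₀ ≤ F (hessianMatrix ψ x₀)

/-- Viscosity supersolution of `F(D²u) = g` on `Ω`. -/
def ViscSupersolution {n : ℕ} (Γ : Set (Fin n → ℝ)) (F : Matrix (Fin n) (Fin n) ℝ → ℝ)
    (g : EuclideanSpace ℝ (Fin n) → ℝ) (Ω : Set (EuclideanSpace ℝ (Fin n)))
    (u : EuclideanSpace ℝ (Fin n) → ℝ) : Prop :=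
  LowerSemicontinuousOn u Ω ∧
    ∀ Aset : Set (EuclideanSpace ℝ (Fin n)), Aset ⊆ Ω → IsOpen Aset →
      ∀ ψ : EuclideanSpace ℝ (Fin n) → ℝ, Admissible Γ Aset ψ →
        ∀ x₀ ∈ Aset, IsLocalMinOn (fun y => u y - ψ y) Aset x₀ →
          F (hessianMatrix ψ x₀) ≤ g x₀

end

/-- `ḡ(t) = 1 + C₀ t^{-β/2}`. -/
noncomputable def gbar (C₀ β t : ℝ) : ℝ := 1 + C₀ * t ^ (-β / 2)

/-- `W(s) = ( s^{-ℋ} ( ∫₁ˢ ℋ t^{ℋ-1} ḡ(t) dt + c₁ ) )^{1/m}`. -/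
noncomputable def Wsub (m : ℕ) (Hc C₀ β c₁ : ℝ) (s : ℝ) : ℝ :=
  (s ^ (-Hc) * ((∫ t in (1:ℝ)..s, Hc * t ^ (Hc - 1) * gbar C₀ β t) + c₁)) ^ ((1 : ℝ) / m)

/-- `w(s) = c₂ + ∫_{s₀}^s W(η) dη`, the generalized symmetric subsolution profile. -/
noncomputable def wProfile (m : ℕ) (Hc C₀ β c₁ c₂ s₀ : ℝ) (s : ℝ) : ℝ :=
  c₂ + ∫ η in s₀..s, Wsub m Hc C₀ β c₁ η

lemma abs_rpow_sub_one_le_abs_sub_one {x p : ℝ} (hx : 0 ≤ x) (hp : 0 ≤ p) (hp1 : p ≤ 1) :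
    |x ^ p - 1| ≤ |x - 1| := by
  rcases le_total 1 x with h | h
  · have h1 : 1 ≤ x ^ p := Real.one_le_rpow h hp
    have h2 : x ^ p ≤ x ^ (1 : ℝ) := Real.rpow_le_rpow_of_exponent_le h hp1
    rw [Real.rpow_one] at h2
    rw [abs_of_nonneg (by linarith), abs_of_nonneg (by linarith)]
    linarith
  · have h1 : x ^ p ≤ 1 := Real.rpow_le_one hx h hp
    have h2 : x ≤ x ^ p := by
      rcases hx.eq_or_lt with rfl | hx0
      · exact Real.rpow_nonneg le_rfl p
      · simpa using Real.rpow_le_rpow_of_exponent_ge hx0 h hp1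
    rw [abs_of_nonpos (by linarith), abs_of_nonpos (by linarith)]
    linarith

lemma continuousOn_rpow_Ici_one (r : ℝ) : ContinuousOn (fun t : ℝ => t ^ r) (Set.Ici 1) :=
  continuousOn_id.rpow_const fun _ ht => Or.inl (zero_lt_one.trans_le ht).ne'

lemma intervalIntegrable_rpow_one {s : ℝ} (hs : 1 ≤ s) (r : ℝ) :
    IntervalIntegrable (fun t : ℝ => t ^ r) volume 1 s := by
  refine ((continuousOn_rpow_Ici_one r).mono ?_).intervalIntegrable
  rw [Set.uIcc_of_le hs]
  exact Set.Icc_subset_Ici_self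

lemma integral_mul_gbar {Hc C₀ β s : ℝ} (hHc : 1 < Hc) (hs : 1 ≤ s) :
    ∫ t in (1 : ℝ)..s, Hc * t ^ (Hc - 1) * gbar C₀ β t =
      s ^ Hc - 1 + Hc * C₀ * ∫ t in (1 : ℝ)..s, t ^ (Hc - β / 2 - 1) := by
  have h : ∫ t in (1 : ℝ)..s, Hc * t ^ (Hc - 1) * gbar C₀ β t =
      ∫ t in (1 : ℝ)..s, (Hc * t ^ (Hc - 1) + Hc * C₀ * t ^ (Hc - β / 2 - 1)) := by
    refine intervalIntegral.integral_congr fun t ht => ?_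
    rw [Set.uIcc_of_le hs] at ht
    have ht0 : 0 < t := zero_lt_one.trans_le ht.1
    have : t ^ (Hc - β / 2 - 1) = t ^ (Hc - 1) * t ^ (-β / 2) := by
      rw [← Real.rpow_add ht0]
      congr 1
      ring
    simp only [gbar, this]
    ring
  rw [h, intervalIntegral.integral_add ((intervalIntegrable_rpow_one hs _).const_mul _)
      ((intervalIntegrable_rpow_one hs _).const_mul _),
    intervalIntegral.integral_const_mul, intervalIntegral.integral_const_mul,
    integral_rpow (Or.inl (by linarith))]
  have : Hc ≠ 0 := by linarith
  simp only [sub_add_cancel, Real.one_rpow]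
  field_simp

lemma integral_rpow_nonneg {s : ℝ} (hs : 1 ≤ s) (r : ℝ) : 0 ≤ ∫ t in (1 : ℝ)..s, t ^ r :=
  intervalIntegral.integral_nonneg hs fun _ ht =>
    Real.rpow_nonneg (zero_le_one.trans ht.1) r

lemma continuousOn_integral_rpow (r : ℝ) :
    ContinuousOn (fun s : ℝ => ∫ t in (1 : ℝ)..s, t ^ r) (Set.Ici 1) := by
  intro s hs
  have hs0 : 0 < s := zero_lt_one.trans_le hs
  refine (intervalIntegral.integral_hasDerivAt_right (intervalIntegrable_rpow_one hs r) ?_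
    (Real.continuousAt_rpow_const s r (Or.inl hs0.ne'))).continuousAt.continuousWithinAt
  exact (measurable_id.pow_const r).stronglyMeasurable.stronglyMeasurableAtFilter

lemma Wsub_base_eq {Hc C₀ β c₁ s : ℝ} (hHc : 1 < Hc) (hs : 1 ≤ s) :
    s ^ (-Hc) * ((∫ t in (1 : ℝ)..s, Hc * t ^ (Hc - 1) * gbar C₀ β t) + c₁) =
      1 + (c₁ - 1) * s ^ (-Hc) +
        Hc * C₀ * (s ^ (-Hc) * ∫ t in (1 : ℝ)..s, t ^ (Hc - β / 2 - 1)) := by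
  have hs0 : 0 < s := zero_lt_one.trans_le hs
  have h : s ^ (-Hc) * s ^ Hc = 1 := by rw [← Real.rpow_add hs0]; simp
  rw [integral_mul_gbar hHc hs]
  linear_combination h

lemma continuousOn_Wsub {m : ℕ} {β C₀ Hc c₁ : ℝ} (hHc : 1 < Hc) :
    ContinuousOn (Wsub m Hc C₀ β c₁) (Set.Ici 1) := by
  have hcont : ContinuousOn (fun s : ℝ => (1 + (c₁ - 1) * s ^ (-Hc) +
      Hc * C₀ * (s ^ (-Hc) * ∫ t in (1 : ℝ)..s, t ^ (Hc - β / 2 - 1))) ^ ((1 : ℝ) / m))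
      (Set.Ici 1) := by
    refine ContinuousOn.rpow_const ?_ fun s _ => Or.inr (by positivity)
    exact (continuousOn_const.add (continuousOn_const.mul (continuousOn_rpow_Ici_one _))).add
      (continuousOn_const.mul ((continuousOn_rpow_Ici_one _).mul (continuousOn_integral_rpow _)))
  refine hcont.congr fun s hs => ?_
  rw [Wsub, Wsub_base_eq hHc hs]

lemma abs_Wsub_sub_one_le {m : ℕ} {β C₀ Hc c₁ s : ℝ} (hm : 1 ≤ m) (hC₀ : 0 < C₀) (hHc : 1 < Hc)
    (hc₁ : 0 < c₁) (hs : 1 ≤ s) :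
    |Wsub m Hc C₀ β c₁ s - 1| ≤ |c₁ - 1| * s ^ (-Hc) +
      Hc * C₀ * (s ^ (-Hc) * ∫ t in (1 : ℝ)..s, t ^ (Hc - β / 2 - 1)) := by
  have hs0 : 0 < s := zero_lt_one.trans_le hs
  have hJ := integral_rpow_nonneg hs (Hc - β / 2 - 1)
  have hpow : 1 ≤ s ^ Hc := Real.one_le_rpow hs (by linarith)
  have hrest : 0 ≤ Hc * C₀ * ∫ t in (1 : ℝ)..s, t ^ (Hc - β / 2 - 1) := by positivity
  have hbase : 0 ≤ s ^ (-Hc) *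
      ((∫ t in (1 : ℝ)..s, Hc * t ^ (Hc - 1) * gbar C₀ β t) + c₁) := by
    rw [integral_mul_gbar hHc hs]
    exact mul_nonneg (Real.rpow_nonneg hs0.le _) (by linarith)
  have hm' : (1 : ℝ) / m ≤ 1 := by
    rw [one_div]
    exact inv_le_one_of_one_le₀ (by exact_mod_cast hm)
  refine (abs_rpow_sub_one_le_abs_sub_one hbase (by positivity) hm').trans ?_
  rw [Wsub_base_eq hHc hs, add_assoc, add_sub_cancel_left]
  refine (abs_add_le _ _).trans (le_of_eq ?_)
  rw [abs_mul, abs_of_nonneg (Real.rpow_nonneg hs0.le (-Hc)), abs_of_nonneg (a := Hc * C₀ * _)]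
  positivity

lemma tendsto_add_mul_log_mul_rpow {p : ℝ} (hp : 1 < p) (a c : ℝ) :
    Tendsto (fun s : ℝ => -((a + c * Real.log s) * s ^ (1 - p))) atTop (nhds 0) := by
  have h1 : Tendsto (fun s : ℝ => s ^ (1 - p)) atTop (nhds 0) := by
    simpa using tendsto_rpow_neg_atTop (y := p - 1) (by linarith)
  have h2 : Tendsto (fun s : ℝ => Real.log s / s ^ (p - 1)) atTop (nhds 0) :=
    (isLittleO_log_rpow_atTop (by linarith)).tendsto_div_nhds_zero
  have h3 := ((h1.const_mul a).add (h2.const_mul c)).neg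
  simp only [mul_zero, add_zero, neg_zero] at h3
  refine h3.congr' ?_
  filter_upwards [eventually_gt_atTop 0] with s hs
  rw [show (1 - p) = -(p - 1) by ring, Real.rpow_neg hs.le]
  ring

/-- A continuous function dominated by `(A + B log s) s ^ (-p)` with `p > 1` is integrable at
infinity, with an explicit bound on its tail integral. -/
lemma integrableOn_and_abs_integral_Ioi_le {f : ℝ → ℝ} {A B p s : ℝ} (hA : 0 ≤ A) (hB : 0 ≤ B)
    (hp : 1 < p) (hs : 1 ≤ s) (hf : ContinuousOn f (Set.Ici 1))
    (hbound : ∀ t, 1 ≤ t → |f t| ≤ (A + B * Real.log t) * t ^ (-p)) :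
    IntegrableOn f (Set.Ioi s) ∧
      |∫ t in Set.Ioi s, f t| ≤
        ((A + B / (p - 1)) / (p - 1) + B / (p - 1) * Real.log s) * s ^ (1 - p) := by
  have hp' : p - 1 ≠ 0 := by linarith
  set c := B / (p - 1) with hc
  set a := (A + c) / (p - 1) with ha
  have hderiv : ∀ t ∈ Set.Ici s, HasDerivAt (fun t : ℝ => -((a + c * Real.log t) * t ^ (1 - p)))
      ((A + B * Real.log t) * t ^ (-p)) t := by
    intro t ht
    have ht0 : 0 < t := zero_lt_one.trans_le (hs.trans ht)
    have h := (((((Real.hasDerivAt_log ht0.ne').const_mul c).const_add a).mul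
      (Real.hasDerivAt_rpow_const (p := 1 - p) (Or.inl ht0.ne')))).neg
    refine h.congr_deriv ?_
    have e1 : t ^ (1 - p) = t * t ^ (-p) := by
      rw [show 1 - p = 1 + -p by ring, Real.rpow_add ht0, Real.rpow_one]
    rw [show 1 - p - 1 = -p by ring, e1, ha, hc]
    field_simp
    ring
  have hnonneg : ∀ t ∈ Set.Ioi s, 0 ≤ (A + B * Real.log t) * t ^ (-p) := by
    intro t ht
    have ht1 : 1 ≤ t := hs.trans (le_of_lt ht)
    have := Real.log_nonneg ht1
    have := Real.rpow_nonneg (zero_le_one.trans ht1) (-p)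
    positivity
  have hlim := tendsto_add_mul_log_mul_rpow hp a c
  have hg := integrableOn_Ioi_deriv_of_nonneg' hderiv hnonneg hlim
  have hval := integral_Ioi_of_hasDerivAt_of_nonneg' hderiv hnonneg hlim
  have hae : ∀ᵐ t ∂(volume.restrict (Set.Ioi s)), ‖f t‖ ≤ (A + B * Real.log t) * t ^ (-p) :=
    (ae_restrict_iff' measurableSet_Ioi).2
      (Eventually.of_forall fun t ht => hbound t (hs.trans (le_of_lt ht)))
  refine ⟨hg.mono' ((hf.mono fun _ ht => hs.trans (le_of_lt ht)).aestronglyMeasurable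
    measurableSet_Ioi) hae, ?_⟩
  have := norm_integral_le_of_norm_le hg hae
  rw [hval, zero_sub, neg_neg] at this
  exact this

lemma wProfile_sub_eq {m : ℕ} {β C₀ Hc s₀ c₁ c₂ s : ℝ} (hHc : 1 < Hc) (hs₀ : 1 < s₀)
    (hs : s₀ ≤ s)
    (hint : IntegrableOn (fun η => Wsub m Hc C₀ β c₁ η - 1) (Set.Ioi s₀)) :
    wProfile m Hc C₀ β c₁ c₂ s₀ s - s -
        (c₂ - s₀ + ∫ η in Set.Ioi s₀, (Wsub m Hc C₀ β c₁ η - 1)) =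
      -∫ η in Set.Ioi s, (Wsub m Hc C₀ β c₁ η - 1) := by
  have hW : IntervalIntegrable (Wsub m Hc C₀ β c₁) volume s₀ s := by
    refine ((continuousOn_Wsub hHc).mono ?_).intervalIntegrable
    rw [Set.uIcc_of_le hs]
    exact fun _ ht => hs₀.le.trans ht.1
  have h1 := intervalIntegral.integral_interval_add_Ioi hint
    (hint.mono_set (Set.Ioi_subset_Ioi hs))
  have h2 := intervalIntegral.integral_sub hW (intervalIntegrable_const (c := (1 : ℝ)))
  rw [intervalIntegral.integral_const, smul_eq_mul, mul_one] at h2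
  rw [wProfile]
  linarith

lemma abs_Wsub_sub_one_le_of_ne {m : ℕ} {β C₀ Hc c₁ s : ℝ} (hm : 1 ≤ m) (hC₀ : 0 < C₀)
    (hHc : 1 < Hc) (hc₁ : 0 < c₁) (hne : Hc ≠ β / 2) (hs : 1 ≤ s) :
    |Wsub m Hc C₀ β c₁ s - 1| ≤
      (|c₁ - 1| + Hc * C₀ / |Hc - β / 2|) * s ^ (-min (β / 2) Hc) := by
  have hs0 : 0 < s := zero_lt_one.trans_le hs
  have hd : Hc - β / 2 ≠ 0 := sub_ne_zero.2 hne
  have hH : s ^ (-Hc) ≤ s ^ (-min (β / 2) Hc) :=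
    Real.rpow_le_rpow_of_exponent_le hs (neg_le_neg (min_le_right _ _))
  have hb : s ^ (-(β / 2)) ≤ s ^ (-min (β / 2) Hc) :=
    Real.rpow_le_rpow_of_exponent_le hs (neg_le_neg (min_le_left _ _))
  have hJ : s ^ (-Hc) * ∫ t in (1 : ℝ)..s, t ^ (Hc - β / 2 - 1) =
      (s ^ (-(β / 2)) - s ^ (-Hc)) / (Hc - β / 2) := by
    rw [integral_rpow (Or.inr ⟨fun h => hd (by linarith), by
      rw [Set.uIcc_of_le hs]
      exact fun h => absurd h.1 (by norm_num)⟩)]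
    rw [show s ^ (-(β / 2)) = s ^ (-Hc) * s ^ (Hc - β / 2) by
      rw [← Real.rpow_add hs0]
      congr 1
      ring]
    simp only [sub_add_cancel, Real.one_rpow]
    ring
  have hJ' : s ^ (-Hc) * ∫ t in (1 : ℝ)..s, t ^ (Hc - β / 2 - 1) ≤
      s ^ (-min (β / 2) Hc) / |Hc - β / 2| := by
    rw [hJ]
    refine (le_abs_self _).trans ?_
    rw [abs_div]
    gcongr
    exact abs_sub_le_of_nonneg_of_le (Real.rpow_nonneg hs0.le _) hb
      (Real.rpow_nonneg hs0.le _) hH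
  calc |Wsub m Hc C₀ β c₁ s - 1| ≤ |c₁ - 1| * s ^ (-Hc) +
        Hc * C₀ * (s ^ (-Hc) * ∫ t in (1 : ℝ)..s, t ^ (Hc - β / 2 - 1)) :=
        abs_Wsub_sub_one_le hm hC₀ hHc hc₁ hs
    _ ≤ |c₁ - 1| * s ^ (-min (β / 2) Hc) +
        Hc * C₀ * (s ^ (-min (β / 2) Hc) / |Hc - β / 2|) := by gcongr
    _ = _ := by ring

lemma abs_Wsub_sub_one_le_of_eq {m : ℕ} {β C₀ Hc c₁ s : ℝ} (hm : 1 ≤ m) (hC₀ : 0 < C₀)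
    (hHc : 1 < Hc) (hc₁ : 0 < c₁) (heq : Hc = β / 2) (hs : 1 ≤ s) :
    |Wsub m Hc C₀ β c₁ s - 1| ≤ (|c₁ - 1| + Hc * C₀ * Real.log s) * s ^ (-Hc) := by
  have hJ : ∫ t in (1 : ℝ)..s, t ^ (Hc - β / 2 - 1) = Real.log s := by
    rw [← heq, sub_self, zero_sub]
    simp only [Real.rpow_neg_one]
    rw [integral_inv_of_pos one_pos (zero_lt_one.trans_le hs), div_one]
  have h := abs_Wsub_sub_one_le (β := β) hm hC₀ hHc hc₁ hs
  rw [hJ] at h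
  linarith

/-- **Asymptotic expansion (2.11)/(2.12)**: for `β > 2` and `ℋ > 1` the integral
`μ = c₂ - s₀ + ∫_{s₀}^∞ (W - 1)` converges and
`w(s) = s + μ + O(s^{1-min{β/2,ℋ}})` (with a logarithmic correction if `ℋ = β/2`). -/
theorem wProfile_asymptotics
    (m : ℕ) (hm : 1 ≤ m) (β C₀ Hc s₀ c₁ c₂ : ℝ)
    (hβ : 2 < β) (hC₀ : 0 < C₀) (hHc : 1 < Hc) (hs₀ : 1 < s₀) (hc₁ : 0 < c₁) :
    MeasureTheory.IntegrableOn (fun η => Wsub m Hc C₀ β c₁ η - 1) (Set.Ioi s₀)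
      MeasureTheory.volume ∧
    (Hc ≠ β / 2 →
      ∃ C s₁ : ℝ, 0 < C ∧ 1 ≤ s₁ ∧ ∀ s : ℝ, s₁ ≤ s →
        |wProfile m Hc C₀ β c₁ c₂ s₀ s - s -
            (c₂ - s₀ + ∫ η in Set.Ioi s₀, (Wsub m Hc C₀ β c₁ η - 1))| ≤
          C * s ^ (1 - min (β / 2) Hc)) ∧
    (Hc = β / 2 →
      ∃ C s₁ : ℝ, 0 < C ∧ 1 < s₁ ∧ ∀ s : ℝ, s₁ ≤ s →
        |wProfile m Hc C₀ β c₁ c₂ s₀ s - s -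
            (c₂ - s₀ + ∫ η in Set.Ioi s₀, (Wsub m Hc C₀ β c₁ η - 1))| ≤
          C * s ^ (1 - Hc) * Real.log s) := by
  have hcont : ContinuousOn (fun η => Wsub m Hc C₀ β c₁ η - 1) (Set.Ici 1) :=
    (continuousOn_Wsub hHc).sub continuousOn_const
  rcases ne_or_eq Hc (β / 2) with hne | heq
  · have hd : 0 < |Hc - β / 2| := abs_pos.2 (sub_ne_zero.2 hne)
    have hp : 1 < min (β / 2) Hc := lt_min (by linarith) hHc
    set A := |c₁ - 1| + Hc * C₀ / |Hc - β / 2| with hA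
    have hA0 : 0 < A := by positivity
    have htail := fun (s : ℝ) (hs : 1 ≤ s) =>
      integrableOn_and_abs_integral_Ioi_le hA0.le le_rfl hp hs hcont fun t ht => by
        rw [zero_mul, add_zero]
        exact abs_Wsub_sub_one_le_of_ne hm hC₀ hHc hc₁ hne ht
    have hint := (htail s₀ hs₀.le).1
    refine ⟨hint, fun _ => ⟨A / (min (β / 2) Hc - 1), s₀, div_pos hA0 (by linarith), hs₀.le,
      fun s hs => ?_⟩, fun h => absurd h hne⟩
    rw [wProfile_sub_eq hHc hs₀ hs hint, abs_neg]
    simpa using (htail s (hs₀.le.trans hs)).2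
  · set B := Hc * C₀ with hB
    have hB0 : 0 < B := by positivity
    have htail := fun (s : ℝ) (hs : 1 ≤ s) =>
      integrableOn_and_abs_integral_Ioi_le (abs_nonneg (c₁ - 1)) hB0.le hHc hs hcont
        fun t ht => abs_Wsub_sub_one_le_of_eq hm hC₀ hHc hc₁ heq ht
    have hint := (htail s₀ hs₀.le).1
    have hH : 0 < Hc - 1 := by linarith
    refine ⟨hint, fun h => absurd heq h, fun _ =>
      ⟨(|c₁ - 1| + B / (Hc - 1)) / (Hc - 1) + B / (Hc - 1), max s₀ (Real.exp 1), by positivity,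
        hs₀.trans_le (le_max_left _ _), fun s hs => ?_⟩⟩
    have hs₀s : s₀ ≤ s := (le_max_left _ _).trans hs
    have hs0 : 0 < s := by linarith
    have hlog : 1 ≤ Real.log s :=
      (Real.le_log_iff_exp_le hs0).2 ((le_max_right _ _).trans hs)
    rw [wProfile_sub_eq hHc hs₀ hs₀s hint, abs_neg]
    refine (htail s (hs₀.le.trans hs₀s)).2.trans ?_
    rw [mul_right_comm]
    refine mul_le_mul_of_nonneg_right ?_ (Real.rpow_nonneg hs0.le _)
    rw [add_mul]
    exact add_le_add_left (le_mul_of_one_le_right (by positivity) hlog) _
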